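/- arXiv:1706.03724 — 5 statements merged into one kernel-verified Lean document; each statement's English description precedes it below -/
import Mathlib

section
/- For every x ≥ k̲ one has (r + q)·K − (r + q − ψ(1))·e^x + f(x) ≤ −(σ²/2)·Φ_q·K ≤ 0; equivalently, q·v̲(x) − χ(x) ≥ (σ²/2)·Φ_q·K for all x ≥ k̲. Moreover the map x ↦ q·v̲(x) − χ(x) = (r + q − ψ(1))·e^x − (r + q)·K − f(x) is strictly increasing on [k̲, ∞), so the first inequality is strict for every x > k̲. -/
open MeasureTheory Real Set Filter Topology

lemma exp_sub_one_sub_id_le_sq_of_nonpos {u : ℝ} (hu : u ≤ 0) :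
    Real.exp u - 1 - u ≤ u ^ 2 := by
  rcases le_or_gt (-1) u with h | h
  · exact (le_abs_self _).trans (Real.abs_exp_sub_one_sub_id_le (abs_le.2 ⟨h, by linarith⟩))
  · have := Real.exp_le_one_iff.2 hu
    nlinarith

/-- The compensated exponential integrand of a Lévy measure on the negative half-line. -/
noncomputable def levyIntegrand (β z : ℝ) : ℝ :=
  Real.exp (β * z) - 1 - Set.indicator (Set.Ioi (-1 : ℝ)) (fun t => β * t) z

lemma abs_levyIntegrand_le {β z : ℝ} (hβ : 0 ≤ β) (hz : z < 0) :
    |levyIntegrand β z| ≤ (1 + β ^ 2) * min 1 (z ^ 2) := by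
  have hu : β * z ≤ 0 := mul_nonpos_of_nonneg_of_nonpos hβ hz.le
  unfold levyIntegrand
  by_cases h : z ∈ Set.Ioi (-1 : ℝ)
  · rw [Set.indicator_of_mem h]
    have hz' : -1 < z := h
    rw [min_eq_right (by nlinarith), abs_of_nonneg (by linarith [Real.add_one_le_exp (β * z)])]
    nlinarith [exp_sub_one_sub_id_le_sq_of_nonpos hu, sq_nonneg z]
  · rw [Set.indicator_of_notMem h]
    have hz' : z ≤ -1 := not_lt.1 h
    have h1 := Real.exp_le_one_iff.2 hu
    have h2 := Real.exp_pos (β * z)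
    rw [min_eq_left (by nlinarith), abs_le]
    constructor <;> nlinarith [sq_nonneg β]

lemma ae_lt_of_measure_Ici_eq_zero {ν : Measure ℝ} {a : ℝ} (hν : ν (Set.Ici a) = 0) :
    ∀ᵐ z ∂ν, z < a := by
  rw [ae_iff]
  simp only [not_lt]
  exact hν

lemma integrable_levyIntegrand {ν : Measure ℝ} (hν : ν (Set.Ici 0) = 0)
    (hνint : ∫⁻ x, ENNReal.ofReal (min 1 (x ^ 2)) ∂ν ≠ ⊤) {β : ℝ} (hβ : 0 ≤ β) :
    Integrable (levyIntegrand β) ν := by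
  have hmin : Integrable (fun x : ℝ => min 1 (x ^ 2)) ν := by
    refine ⟨by fun_prop, ?_⟩
    rw [hasFiniteIntegral_iff_ofReal (Eventually.of_forall fun x => by positivity)]
    exact hνint.lt_top
  refine (hmin.const_mul (1 + β ^ 2)).mono' ?_ ?_
  · have : Measurable (levyIntegrand β) := by
      unfold levyIntegrand
      exact (by fun_prop : Measurable fun z : ℝ => Real.exp (β * z) - 1).sub
        ((by fun_prop : Measurable fun t : ℝ => β * t).indicator measurableSet_Ioi)
    exact this.aestronglyMeasurable
  · filter_upwards [ae_lt_of_measure_Ici_eq_zero hν] with z hz using abs_levyIntegrand_le hβ hz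

lemma levyIntegrand_sub_mul_levyIntegrand_one (β z : ℝ) :
    levyIntegrand β z - β * levyIntegrand 1 z =
      Real.exp (β * z) - β * Real.exp z + (β - 1) := by
  unfold levyIntegrand
  by_cases h : z ∈ Set.Ioi (-1 : ℝ)
  · simp only [Set.indicator_of_mem h, one_mul]
    ring
  · simp only [Set.indicator_of_notMem h, one_mul]
    ring

lemma antitoneOn_exp_mul_sub_mul_exp {β : ℝ} (hβ : 1 ≤ β) :
    AntitoneOn (fun y : ℝ => Real.exp (β * y) - β * Real.exp y + (β - 1)) (Set.Iic 0) := by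
  have hd : ∀ y : ℝ, HasDerivAt (fun y : ℝ => Real.exp (β * y) - β * Real.exp y + (β - 1))
      (Real.exp (β * y) * (β * 1) - β * Real.exp y) y := fun y =>
    ((((hasDerivAt_id y).const_mul β).exp).sub ((Real.hasDerivAt_exp y).const_mul β)).add_const _
  refine antitoneOn_of_deriv_nonpos (convex_Iic 0) (by fun_prop)
    (fun y _ => (hd y).differentiableAt.differentiableWithinAt) fun y hy => ?_
  rw [interior_Iic] at hy
  have hy : y < 0 := hy
  rw [(hd y).deriv]
  have : Real.exp (β * y) ≤ Real.exp y := Real.exp_le_exp.2 (by nlinarith)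
  nlinarith

/-- Inequality (4.25)/(4.33) (`eq:supervl`, `eq:fneg`): for `x ≥ k̲`,
`(r+q)K − (r+q−ψ(1))eˣ + f(x) ≤ −(σ²/2)Φ(r+q)K ≤ 0`; equivalently
`q·v̲(x) − χ(x) ≥ (σ²/2)Φ(r+q)K`, the map `x ↦ q·v̲(x) − χ(x)` equals
`(r+q−ψ(1))eˣ − (r+q)K − f(x)` and is strictly increasing on `[k̲,∞)`, so the
inequality is strict for `x > k̲`. -/
theorem stmt10
    (μ σ : ℝ) (ν : MeasureTheory.Measure ℝ)
    (hν : ν (Set.Ici 0) = 0)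
    (hνint : ∫⁻ x, ENNReal.ofReal (min 1 (x ^ 2)) ∂ν ≠ ⊤)
    (ψ : ℝ → ℝ)
    (hψ : ∀ β : ℝ, 0 ≤ β →
      ψ β = μ * β + σ ^ 2 / 2 * β ^ 2 +
        ∫ z, (Real.exp (β * z) - 1 -
          Set.indicator (Set.Ioi (-1 : ℝ)) (fun t => β * t) z) ∂ν)
    (Φ : ℝ → ℝ)
    (hΦ : ∀ s : ℝ, 0 ≤ s → 0 ≤ Φ s ∧ ψ (Φ s) = s ∧ ∀ β : ℝ, Φ s < β → s < ψ β)
    (r q : ℝ) (hr : 0 < r) (hq : 0 < q)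
    (hrψ : ψ 1 < r)
    (K : ℝ) (hK : 0 < K)
    (Kl kl : ℝ)
    (hKl : Kl = Φ (r + q) * K / (Φ (r + q) - 1))
    (hkl : kl = Real.log Kl)
    (v : ℝ → ℝ)
    (hv1 : ∀ x : ℝ, x ≤ kl → v x = (Kl - K) * Real.exp (Φ (r + q) * (x - kl)))
    (hv2 : ∀ x : ℝ, kl < x → v x = Real.exp x - K)
    (h : ℝ → ℝ) (hh : ∀ x : ℝ, h x = v x - (Real.exp x - K))
    (h' : ℝ → ℝ) (hh' : ∀ x : ℝ, HasDerivAt h (h' x) x)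
    (f : ℝ → ℝ)
    (hf : ∀ x : ℝ, kl ≤ x → f x = ∫ w in Set.Iio (kl - x), h (x + w) ∂ν)
    (χ : ℝ → ℝ)
    (hχ1 : ∀ x : ℝ, kl ≤ x → χ x = r * K - (r - ψ 1) * Real.exp x + f x)
    (hχ2 : ∀ x : ℝ, x < kl → χ x = q * v x)
    :
    (∀ x : ℝ, kl ≤ x →
      (r + q) * K - (r + q - ψ 1) * Real.exp x + f x ≤ -(σ ^ 2 / 2 * Φ (r + q) * K)) ∧
    -(σ ^ 2 / 2 * Φ (r + q) * K) ≤ 0 ∧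
    (∀ x : ℝ, kl ≤ x → σ ^ 2 / 2 * Φ (r + q) * K ≤ q * v x - χ x) ∧
    (∀ x : ℝ, kl ≤ x →
      q * v x - χ x = (r + q - ψ 1) * Real.exp x - (r + q) * K - f x) ∧
    StrictMonoOn (fun x => q * v x - χ x) (Set.Ici kl) ∧
    (∀ x : ℝ, kl < x → σ ^ 2 / 2 * Φ (r + q) * K < q * v x - χ x) := by
  obtain ⟨-, hψΦ, hΦlt⟩ := hΦ (r + q) (by positivity)
  set b := Φ (r + q)
  have hb1 : 1 < b := by
    by_contra! hle
    rcases hle.lt_or_eq with hlt | heq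
    · linarith [hΦlt 1 hlt]
    · rw [heq] at hψΦ
      linarith
  have hb0 : 0 < b - 1 := by linarith
  have hKl0 : 0 < Kl := by rw [hKl]; positivity
  have hKlK : Kl - K = K / (b - 1) := by rw [hKl]; field_simp; ring
  have hekl : Real.exp kl = Kl := by rw [hkl, Real.exp_log hKl0]
  have hvx : ∀ x, kl ≤ x → v x = Real.exp x - K := by
    intro x hx
    rcases hx.eq_or_lt with rfl | hx
    · rw [hv1 _ le_rfl, sub_self, mul_zero, Real.exp_zero, mul_one, hekl]
    · exact hv2 x hx
  set g : ℝ → ℝ := fun y => Real.exp (b * y) - b * Real.exp y + (b - 1) with hg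
  have hg0 : g 0 = 0 := by simp [hg]
  have hganti : AntitoneOn g (Set.Iic 0) := antitoneOn_exp_mul_sub_mul_exp hb1.le
  have hgnonneg : ∀ y, 0 ≤ g (min y 0) := fun y =>
    hg0.symm.le.trans
      (hganti (Set.mem_Iic.2 (min_le_right y 0)) (Set.mem_Iic.2 le_rfl) (min_le_right y 0))
  have hhg : ∀ x, x ≤ kl → h x = K / (b - 1) * g (x - kl) := by
    intro x hx
    have : Real.exp x = Kl * Real.exp (x - kl) := by
      rw [← hekl, ← Real.exp_add]
      congr 1
      ring
    rw [hh, hv1 x hx, hKlK, this, hKl]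
    simp only [hg]
    field_simp
    ring
  have hfg : ∀ x, kl ≤ x → f x = K / (b - 1) * ∫ w, g (min (x - kl + w) 0) ∂ν := by
    intro x hx
    rw [hf x hx, ← integral_indicator measurableSet_Iio, ← integral_const_mul]
    congr 1
    funext w
    by_cases hw : w ∈ Set.Iio (kl - x)
    · have hw' : w < kl - x := hw
      rw [Set.indicator_of_mem hw, hhg _ (by linarith), min_eq_left (by linarith)]
      congr 2
      ring
    · have hw' : kl - x ≤ w := not_lt.1 hw
      rw [Set.indicator_of_notMem hw, min_eq_right (by linarith), hg0, mul_zero]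
  have hib := integrable_levyIntegrand hν hνint (zero_le_one.trans hb1.le)
  have hi1 := integrable_levyIntegrand hν hνint zero_le_one
  have hgl : ∀ z, g z = levyIntegrand b z - b * levyIntegrand 1 z := fun z =>
    (levyIntegrand_sub_mul_levyIntegrand_one b z).symm
  have hgi : Integrable g ν := by
    rw [funext hgl]
    exact hib.sub (hi1.const_mul b)
  have hneg : ∀ᵐ z ∂ν, z < 0 := ae_lt_of_measure_Ici_eq_zero hν
  have hgti : ∀ t, 0 ≤ t → Integrable (fun w => g (min (t + w) 0)) ν := by
    intro t ht
    refine hgi.mono' (by fun_prop) ?_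
    filter_upwards [hneg] with w hw
    rw [Real.norm_of_nonneg (hgnonneg _)]
    exact hganti hw.le (Set.mem_Iic.2 (min_le_right _ _)) (le_min (by linarith) hw.le)
  have hfanti : AntitoneOn f (Set.Ici kl) := by
    intro x hx y hy hxy
    rw [hfg x hx, hfg y hy]
    refine mul_le_mul_of_nonneg_left ?_ (by positivity)
    refine integral_mono (hgti _ (sub_nonneg.2 hy)) (hgti _ (sub_nonneg.2 hx)) fun w => ?_
    exact hganti (Set.mem_Iic.2 (min_le_right _ _)) (Set.mem_Iic.2 (min_le_right _ _))
      (min_le_min_right _ (by linarith))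
  have hψ1 : ψ 1 = μ * 1 + σ ^ 2 / 2 * 1 ^ 2 + ∫ z, levyIntegrand 1 z ∂ν := hψ 1 zero_le_one
  have hψb : ψ b = μ * b + σ ^ 2 / 2 * b ^ 2 + ∫ z, levyIntegrand b z ∂ν :=
    hψ b (zero_le_one.trans hb1.le)
  have hfkl : f kl = K / (b - 1) *
      (∫ z, levyIntegrand b z ∂ν - b * ∫ z, levyIntegrand 1 z ∂ν) := by
    rw [hfg kl le_rfl, ← integral_const_mul b, ← integral_sub hib (hi1.const_mul b)]
    congr 1
    refine integral_congr_ae ?_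
    filter_upwards [hneg] with w hw
    rw [sub_self, zero_add, min_eq_left hw.le, hgl]
  have heq : ∀ x, kl ≤ x →
      q * v x - χ x = (r + q - ψ 1) * Real.exp x - (r + q) * K - f x := by
    intro x hx
    rw [hvx x hx, hχ1 x hx]
    ring
  have hatkl : q * v kl - χ kl = σ ^ 2 / 2 * b * K := by
    rw [heq kl le_rfl, hekl, hfkl, hKl, ← hψΦ, hψ1, hψb]
    field_simp
    ring
  have hmono : StrictMonoOn (fun x => q * v x - χ x) (Set.Ici kl) := by
    intro x hx y hy hxy
    have hexp : (r + q - ψ 1) * Real.exp x < (r + q - ψ 1) * Real.exp y :=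
      mul_lt_mul_of_pos_left (Real.exp_lt_exp.2 hxy) (by linarith)
    have hfxy := hfanti hx hy hxy.le
    simp only [heq x hx, heq y hy]
    linarith
  have hge : ∀ x, kl ≤ x → σ ^ 2 / 2 * b * K ≤ q * v x - χ x := fun x hx =>
    hatkl ▸ hmono.monotoneOn (Set.mem_Ici.2 le_rfl) hx hx
  refine ⟨fun x hx => ?_, ?_, hge, heq, hmono, fun x hx => ?_⟩
  · linarith [hge x hx, heq x hx]
  · rw [neg_nonpos]
    positivity
  · exact hatkl ▸ hmono (Set.mem_Ici.2 le_rfl) hx.le hx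
end

section
/- The function χ is strictly decreasing on [k̲, ∞) with lim_{x→∞} χ(x) = −∞, and χ(x) > 0 for every x < k̲. Consequently there exists a unique y_m ∈ [k̲, ∞) such that χ(x) > 0 for all x < y_m and χ(x) ≤ 0 for all x ≥ y_m. -/
open MeasureTheory Real Set Filter Topology

/-- A second-order Taylor bound for the exponential, valid on the whole negative half-line. -/
lemma exp_le_one_add_add_sq_of_nonpos {t : ℝ} (ht : t ≤ 0) : Real.exp t ≤ 1 + t + t ^ 2 := by
  by_cases h1 : -1 ≤ t
  · have := (abs_le.1 (Real.abs_exp_sub_one_sub_id_le (abs_le.2 ⟨h1, by linarith⟩))).2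
    linarith
  · have := Real.exp_le_one_iff.2 ht
    nlinarith

/-- The difference between an exponential of rate `a ≥ 1` and its tangent multiple of `exp`. -/
noncomputable def expGap (a u : ℝ) : ℝ := Real.exp (a * u) - a * Real.exp u + (a - 1)

lemma antitoneOn_expGap {a : ℝ} (ha : 1 ≤ a) : AntitoneOn (expGap a) (Set.Iic 0) := by
  have hd : ∀ u, HasDerivAt (expGap a) (a * (Real.exp (a * u) - Real.exp u)) u := by
    intro u
    have h1 : HasDerivAt (fun u => Real.exp (a * u)) (Real.exp (a * u) * (a * 1)) u :=
      ((hasDerivAt_id u).const_mul a).exp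
    have h2 := (h1.sub ((Real.hasDerivAt_exp u).const_mul a)).add_const (a - 1)
    exact h2.congr_deriv (by ring)
  refine antitoneOn_of_deriv_nonpos (convex_Iic 0)
    (fun u _ => (hd u).continuousAt.continuousWithinAt)
    (fun u _ => (hd u).differentiableAt.differentiableWithinAt) fun u hu => ?_
  rw [interior_Iic] at hu
  have hu' : u < 0 := hu
  rw [(hd u).deriv]
  have : Real.exp (a * u) ≤ Real.exp u := Real.exp_le_exp.2 (by nlinarith)
  nlinarith

lemma expGap_zero (a : ℝ) : expGap a 0 = 0 := by simp [expGap]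

lemma expGap_nonneg {a u : ℝ} (ha : 1 ≤ a) (hu : u ≤ 0) : 0 ≤ expGap a u :=
  expGap_zero a ▸ antitoneOn_expGap ha hu Set.self_mem_Iic hu

lemma expGap_le {a u : ℝ} (ha : 1 ≤ a) (hu : u ≤ 0) : expGap a u ≤ a ^ 2 * min 1 (u ^ 2) := by
  have h1 : Real.exp (a * u) ≤ 1 := Real.exp_le_one_iff.2 (by nlinarith)
  have h2 := exp_le_one_add_add_sq_of_nonpos (t := a * u) (by nlinarith)
  have h3 := mul_le_mul_of_nonneg_left (Real.add_one_le_exp u) (by linarith : 0 ≤ a)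
  have h4 : 0 ≤ a * Real.exp u := mul_nonneg (by linarith) (Real.exp_pos u).le
  unfold expGap
  rcases min_cases 1 (u ^ 2) with ⟨h, _⟩ | ⟨h, _⟩ <;> rw [h] <;> nlinarith

/-- Translates of an antitone nonnegative continuous function, integrated against a measure for
which the leftmost translate is integrable, give an antitone continuous function. -/
lemma antitoneOn_and_continuousOn_integral_translate {ν : Measure ℝ} {h : ℝ → ℝ} {c : ℝ}
    (hanti : Antitone h) (hpos : ∀ x, 0 ≤ h x) (hcont : Continuous h)
    (hint : Integrable (fun w => h (c + w)) ν) :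
    AntitoneOn (fun x => ∫ w, h (x + w) ∂ν) (Set.Ici c) ∧
      ContinuousOn (fun x => ∫ w, h (x + w) ∂ν) (Set.Ici c) := by
  have hmeas : ∀ x, AEStronglyMeasurable (fun w => h (x + w)) ν := fun x =>
    (hcont.comp (continuous_const.add continuous_id)).aestronglyMeasurable
  have hbound : ∀ x ∈ Set.Ici c, ∀ᵐ w ∂ν, ‖h (x + w)‖ ≤ h (c + w) := fun x hx =>
    Eventually.of_forall fun w => by
      rw [Real.norm_of_nonneg (hpos _)]
      exact hanti (add_le_add_left (Set.mem_Ici.1 hx) w)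
  have hI : ∀ x ∈ Set.Ici c, Integrable (fun w => h (x + w)) ν := fun x hx =>
    hint.mono' (hmeas x) (hbound x hx)
  refine ⟨fun x hx y hy hxy => integral_mono (hI y hy) (hI x hx) fun w =>
      hanti (add_le_add_left hxy w), ?_⟩
  exact continuousOn_of_dominated (fun x _ => hmeas x) hbound hint
    (Eventually.of_forall fun w => (hcont.comp (continuous_id.add continuous_const)).continuousOn)

/-- Existence and uniqueness of the critical level `y_m` (display (4.27),
`ym`): `χ` is strictly decreasing on `[k̲,∞)` with `χ(∞) = −∞`, `χ > 0` below
`k̲`, and there is a unique `y_m ≥ k̲` with `χ > 0` on `(−∞, y_m)` and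
`χ ≤ 0` on `[y_m, ∞)`. -/
theorem stmt11
    (μ σ : ℝ) (ν : MeasureTheory.Measure ℝ)
    (hν : ν (Set.Ici 0) = 0)
    (hνint : ∫⁻ x, ENNReal.ofReal (min 1 (x ^ 2)) ∂ν ≠ ⊤)
    (ψ : ℝ → ℝ)
    (hψ : ∀ β : ℝ, 0 ≤ β →
      ψ β = μ * β + σ ^ 2 / 2 * β ^ 2 +
        ∫ z, (Real.exp (β * z) - 1 -
          Set.indicator (Set.Ioi (-1 : ℝ)) (fun t => β * t) z) ∂ν)
    (Φ : ℝ → ℝ)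
    (hΦ : ∀ s : ℝ, 0 ≤ s → 0 ≤ Φ s ∧ ψ (Φ s) = s ∧ ∀ β : ℝ, Φ s < β → s < ψ β)
    (r q : ℝ) (hr : 0 < r) (hq : 0 < q)
    (hrψ : ψ 1 < r)
    (K : ℝ) (hK : 0 < K)
    (Kl kl : ℝ)
    (hKl : Kl = Φ (r + q) * K / (Φ (r + q) - 1))
    (hkl : kl = Real.log Kl)
    (v : ℝ → ℝ)
    (hv1 : ∀ x : ℝ, x ≤ kl → v x = (Kl - K) * Real.exp (Φ (r + q) * (x - kl)))
    (hv2 : ∀ x : ℝ, kl < x → v x = Real.exp x - K)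
    (h : ℝ → ℝ) (hh : ∀ x : ℝ, h x = v x - (Real.exp x - K))
    (h' : ℝ → ℝ) (hh' : ∀ x : ℝ, HasDerivAt h (h' x) x)
    (f : ℝ → ℝ)
    (hf : ∀ x : ℝ, kl ≤ x → f x = ∫ w in Set.Iio (kl - x), h (x + w) ∂ν)
    (χ : ℝ → ℝ)
    (hχ1 : ∀ x : ℝ, kl ≤ x → χ x = r * K - (r - ψ 1) * Real.exp x + f x)
    (hχ2 : ∀ x : ℝ, x < kl → χ x = q * v x)
    :
    StrictAntiOn χ (Set.Ici kl) ∧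
    Filter.Tendsto χ Filter.atTop Filter.atBot ∧
    (∀ x : ℝ, x < kl → 0 < χ x) ∧
    (∃! ym : ℝ, kl ≤ ym ∧ (∀ x : ℝ, x < ym → 0 < χ x) ∧
      ∀ x : ℝ, ym ≤ x → χ x ≤ 0) := by
  set a := Φ (r + q) with ha_def
  obtain ⟨-, hψa, hgt⟩ := hΦ (r + q) (by linarith)
  have ha : 1 < a := by
    by_contra! hle
    rcases hle.eq_or_lt with heq | hlt
    · rw [← ha_def, heq] at hψa
      linarith
    · linarith [hgt 1 hlt]
  have ha1 : 0 < a - 1 := by linarith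
  have hKl_pos : 0 < Kl := hKl ▸ div_pos (mul_pos (by linarith) hK) ha1
  have hexp : Real.exp kl = Kl := hkl ▸ Real.exp_log hKl_pos
  set C := K / (a - 1) with hC
  have hC_pos : 0 < C := div_pos hK ha1
  have hKC : K = C * (a - 1) := by rw [hC]; field_simp
  have hKlC : Kl = C * a := by rw [hKl, hC]; ring
  have h_left : ∀ x, x ≤ kl → h x = C * expGap a (x - kl) := by
    intro x hx
    have hx' : Real.exp x = Kl * Real.exp (x - kl) := by
      rw [← hexp, ← Real.exp_add]; congr 1; ring
    rw [hh, hv1 x hx, hx', hKlC, expGap, hKC]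
    ring
  have h_right : ∀ x, kl ≤ x → h x = 0 := by
    intro x hx
    rcases hx.eq_or_lt with rfl | hlt
    · rw [h_left _ le_rfl, sub_self, expGap_zero, mul_zero]
    · rw [hh, hv2 x hlt, sub_self]
  have h_nonneg : ∀ x, 0 ≤ h x := by
    intro x
    rcases le_total x kl with hx | hx
    · rw [h_left x hx]
      exact mul_nonneg hC_pos.le (expGap_nonneg ha.le (by linarith))
    · rw [h_right x hx]
  have h_anti : Antitone h := by
    intro x y hxy
    rcases le_total y kl with hy | hy
    · rw [h_left y hy, h_left x (hxy.trans hy)]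
      exact mul_le_mul_of_nonneg_left (antitoneOn_expGap ha.le
        (Set.mem_Iic.2 (by linarith)) (Set.mem_Iic.2 (by linarith)) (by linarith)) hC_pos.le
    · rw [h_right y hy]
      exact h_nonneg x
  have h_cont : Continuous h := continuous_iff_continuousAt.2 fun x => (hh' x).continuousAt
  have hmin : Integrable (fun x : ℝ => min 1 (x ^ 2)) ν := by
    refine ⟨(continuous_const.min (continuous_id.pow 2)).aestronglyMeasurable, ?_⟩
    rw [hasFiniteIntegral_iff_ofReal
      (Eventually.of_forall fun x => le_min zero_le_one (sq_nonneg x))]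
    exact lt_top_iff_ne_top.2 hνint
  have hint : Integrable (fun w => h (kl + w)) ν := by
    refine (hmin.const_mul (C * a ^ 2)).mono'
      (h_cont.comp (continuous_const.add continuous_id)).aestronglyMeasurable
      (Eventually.of_forall fun w => ?_)
    rw [Real.norm_of_nonneg (h_nonneg _)]
    rcases le_total w 0 with hw | hw
    · rw [h_left _ (by linarith), add_sub_cancel_left, mul_assoc]
      exact mul_le_mul_of_nonneg_left (expGap_le ha.le hw) hC_pos.le
    · rw [h_right _ (by linarith)]
      positivity
  obtain ⟨hF_anti, hF_cont⟩ :=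
    antitoneOn_and_continuousOn_integral_translate h_anti h_nonneg h_cont hint
  have hf_eq : Set.EqOn f (fun x => ∫ w, h (x + w) ∂ν) (Set.Ici kl) := by
    intro x hx
    rw [hf x hx]
    refine setIntegral_eq_integral_of_forall_compl_eq_zero fun w hw => h_right _ ?_
    have : kl - x ≤ w := by simpa using hw
    linarith
  have hf_anti : AntitoneOn f (Set.Ici kl) := hF_anti.congr hf_eq.symm
  have hf_cont : ContinuousOn f (Set.Ici kl) := hF_cont.congr hf_eq
  have hr1 : 0 < r - ψ 1 := by linarith
  have hχ_anti : StrictAntiOn χ (Set.Ici kl) := by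
    intro x hx y hy hxy
    rw [hχ1 x hx, hχ1 y hy]
    have h1 := hf_anti hx hy hxy.le
    have h2 := mul_lt_mul_of_pos_left (Real.exp_lt_exp.2 hxy) hr1
    linarith
  have hχ_tendsto : Tendsto χ atTop atBot := by
    have hlim : Tendsto (fun x => (r * K + f kl) + -((r - ψ 1) * Real.exp x)) atTop atBot :=
      tendsto_atBot_add_const_left _ _
        (tendsto_neg_atTop_atBot.comp (Real.tendsto_exp_atTop.const_mul_atTop hr1))
    refine tendsto_atBot_mono' _ ?_ hlim
    filter_upwards [eventually_ge_atTop kl] with x hx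
    rw [hχ1 x hx]
    linarith [hf_anti Set.self_mem_Ici hx hx]
  have hχ_pos : ∀ x : ℝ, x < kl → 0 < χ x := by
    intro x hx
    rw [hχ2 x hx, hv1 x hx.le]
    have : Kl - K = C := by rw [hKlC, hKC]; ring
    rw [this]
    positivity
  have hχ_cont : ContinuousOn χ (Set.Ici kl) := by
    refine ContinuousOn.congr (f := fun x => r * K - (r - ψ 1) * Real.exp x + f x) ?_ hχ1
    exact (continuous_const.sub
      (continuous_const.mul Real.continuous_exp)).continuousOn.add hf_cont
  refine ⟨hχ_anti, hχ_tendsto, hχ_pos, existsUnique_of_exists_of_unique ?_ ?_⟩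
  · rcases le_or_gt (χ kl) 0 with hkl0 | hkl0
    · exact ⟨kl, le_rfl, hχ_pos, fun x hx =>
        (hχ_anti.antitoneOn Set.self_mem_Ici hx hx).trans hkl0⟩
    · obtain ⟨X, hX, hX0⟩ :=
        ((eventually_ge_atTop kl).and (hχ_tendsto.eventually_le_atBot 0)).exists
      obtain ⟨y, hy, hy0⟩ := intermediate_value_Icc' hX
        (hχ_cont.mono Set.Icc_subset_Ici_self) ⟨hX0, hkl0.le⟩
      refine ⟨y, hy.1, fun x hx => ?_, fun x hx => ?_⟩
      · rcases lt_or_ge x kl with hxk | hxk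
        · exact hχ_pos x hxk
        · exact hy0 ▸ hχ_anti hxk hy.1 hx
      · exact hy0 ▸ hχ_anti.antitoneOn hy.1 (Set.mem_Ici.2 (hy.1.trans hx)) hx
  · rintro y z ⟨-, hy1, hy2⟩ ⟨-, hz1, hz2⟩
    rcases lt_trichotomy y z with hlt | heq | hlt
    · exact absurd (hz1 y hlt) (hy2 y le_rfl).not_gt
    · exact heq
    · exact absurd (hy1 z hlt) (hz2 z le_rfl).not_gt
end

section
/- Let k̲ ≤ a < y. Then Δ(a, a; y) = 0; for every x ∈ (a, y) one has the representation Δ(x, a; y) = ∫_{(0, x−a)} ( q·v̲(x − z) − χ(x − z) )·W^{(r+q)}(z) dz; and Δ(x, a; y) > 0 for every x ∈ (a, y]. -/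
open MeasureTheory Real Set Filter Topology

/-- The compensated exponential in the Lévy–Khintchine formula of a spectrally negative process
is integrable. -/
theorem integrable_compensated_exp {ν : Measure ℝ} (hν : ν (Set.Ici 0) = 0)
    (hνint : ∫⁻ x, ENNReal.ofReal (min 1 (x ^ 2)) ∂ν ≠ ⊤) {β : ℝ} (hβ : 0 ≤ β) :
    Integrable (fun z => Real.exp (β * z) - 1 -
      Set.indicator (Set.Ioi (-1 : ℝ)) (fun t => β * t) z) ν := by
  have hmin : Integrable (fun x : ℝ => min 1 (x ^ 2)) ν := by
    refine ⟨by fun_prop, ?_⟩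
    rw [hasFiniteIntegral_iff_ofReal (Eventually.of_forall fun x => by positivity)]
    exact lt_top_iff_ne_top.mpr hνint
  have hneg : ∀ᵐ z ∂ν, z < 0 := by
    rw [ae_iff]
    simpa [Set.Ici, not_lt] using hν
  refine (hmin.const_mul (1 + β ^ 2)).mono' ?_ ?_
  · refine Measurable.aestronglyMeasurable ?_
    exact ((by fun_prop : Measurable fun z : ℝ => Real.exp (β * z) - 1)).sub
      ((by fun_prop : Measurable fun t : ℝ => β * t).indicator measurableSet_Ioi)
  · filter_upwards [hneg] with z hz
    have hu : β * z ≤ 0 := mul_nonpos_of_nonneg_of_nonpos hβ hz.le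
    have he : Real.exp (β * z) ≤ 1 := Real.exp_le_one_iff.mpr hu
    have he0 := Real.exp_pos (β * z)
    have hl := Real.add_one_le_exp (β * z)
    rw [Real.norm_eq_abs]
    by_cases h1 : -1 < z
    · rw [Set.indicator_of_mem (Set.mem_Ioi.mpr h1), min_eq_right (by nlinarith),
        abs_of_nonneg (by linarith)]
      have hsq : Real.exp (β * z) - 1 - β * z ≤ (β * z) ^ 2 := by
        by_cases h2 : -1 ≤ β * z
        · have := Real.norm_exp_sub_one_sub_id_le (x := β * z)
            (by rw [Real.norm_eq_abs, abs_le]; constructor <;> linarith)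
          rw [Real.norm_eq_abs, Real.norm_eq_abs, sq_abs] at this
          exact (le_abs_self _).trans this
        · nlinarith
      nlinarith [sq_nonneg z]
    · rw [Set.indicator_of_notMem (by simpa using h1), min_eq_left (by nlinarith), abs_le]
      constructor <;> nlinarith [sq_nonneg β]

/-- If `A * φ = L`, the difference of exponentials touches zero smoothly and is nonincreasing
to the left of its contact point. -/
theorem antitoneOn_exp_sub_exp {A L K φ : ℝ} (hφ : 1 < φ) (hL : 0 < L) (hA : A * φ = L) :
    AntitoneOn (fun t => A * Real.exp (φ * t) - L * Real.exp t + K) (Set.Iic 0) := by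
  have hd : ∀ t : ℝ, HasDerivAt (fun t => A * Real.exp (φ * t) - L * Real.exp t + K)
      (L * (Real.exp (φ * t) - Real.exp t)) t := by
    intro t
    have h1 := (((hasDerivAt_id t).const_mul φ).exp.const_mul A)
    have h2 := (Real.hasDerivAt_exp t).const_mul L
    refine ((h1.sub h2).add_const K).congr_deriv ?_
    rw [← hA]
    simp only [id]
    ring
  refine antitoneOn_of_deriv_nonpos (convex_Iic 0)
    (fun t _ => (hd t).continuousAt.continuousWithinAt)
    (fun t _ => (hd t).differentiableAt.differentiableWithinAt) ?_
  intro t ht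
  rw [interior_Iic] at ht
  rw [(hd t).deriv]
  have : Real.exp (φ * t) ≤ Real.exp t := Real.exp_le_exp.mpr (by nlinarith [Set.mem_Iio.mp ht])
  nlinarith

/-- For a nonnegative function that is nonincreasing on the negative half-line, the overshoot
integral below level zero is nonincreasing in the starting point. -/
theorem antitoneOn_integral_overshoot {ν : Measure ℝ} {k : ℝ → ℝ} (hk : Measurable k)
    (hanti : AntitoneOn k (Set.Iic 0)) (hnn : ∀ t ≤ 0, 0 ≤ k t) (hint : Integrable k ν) :
    AntitoneOn (fun s => ∫ w in Set.Iio (-s), k (s + w) ∂ν) (Set.Ici 0) := by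
  have hI : ∀ s : ℝ, 0 ≤ s → IntegrableOn (fun w => k (s + w)) (Set.Iio (-s)) ν := by
    intro s hs
    refine Integrable.mono' hint.integrableOn
      (by fun_prop : Measurable fun w => k (s + w)).aestronglyMeasurable ?_
    filter_upwards [ae_restrict_mem measurableSet_Iio] with w hw
    have hw' : w < -s := hw
    rw [Real.norm_of_nonneg (hnn _ (by linarith))]
    exact hanti (Set.mem_Iic.mpr (by linarith)) (Set.mem_Iic.mpr (by linarith)) (by linarith)
  intro s hs t ht hst
  have hs' : 0 ≤ s := hs
  have ht' : 0 ≤ t := ht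
  have hsub : Set.Iio (-t) ⊆ Set.Iio (-s) := Set.Iio_subset_Iio (by linarith)
  calc ∫ w in Set.Iio (-t), k (t + w) ∂ν ≤ ∫ w in Set.Iio (-t), k (s + w) ∂ν := by
        refine setIntegral_mono_on (hI t ht') ((hI s hs').mono_set hsub) measurableSet_Iio ?_
        intro w hw
        have hw' : w < -t := hw
        exact hanti (Set.mem_Iic.mpr (by linarith)) (Set.mem_Iic.mpr (by linarith)) (by linarith)
    _ ≤ ∫ w in Set.Iio (-s), k (s + w) ∂ν := by
        refine setIntegral_mono_set (hI s hs') ?_ hsub.eventuallyLE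
        filter_upwards [ae_restrict_mem measurableSet_Iio] with w hw
        have hw' : w < -s := hw
        exact hnn _ (by linarith)

/-- Convolution on a half-line of a kernel vanishing on the negatives, with the kernel moved to
the integration variable. -/
theorem setIntegral_kernel_sub {w g : ℝ → ℝ} (hw : ∀ x < 0, w x = 0) {a x y : ℝ}
    (hax : a ≤ x) (hxy : x ≤ y) :
    ∫ u in Set.Ioo a y, w (x - u) * g u = ∫ z in (0 : ℝ)..(x - a), g (x - z) * w z := by
  have h1 : ∫ u in Set.Ioo a y, w (x - u) * g u = ∫ u in Set.Ioc a x, w (x - u) * g u := by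
    rw [← integral_Ioc_eq_integral_Ioo]
    refine setIntegral_eq_of_subset_of_forall_sdiff_eq_zero measurableSet_Ioc
      (Set.Ioc_subset_Ioc_right hxy) ?_
    rintro u ⟨⟨hu1, -⟩, hu3⟩
    have : x < u := by
      by_contra hc
      exact hu3 ⟨hu1, not_lt.mp hc⟩
    rw [hw _ (by linarith), zero_mul]
  rw [h1, ← intervalIntegral.integral_of_le hax]
  have := intervalIntegral.integral_comp_sub_left (a := (0 : ℝ)) (b := x - a)
    (fun u => w (x - u) * g u) x
  simp only [sub_sub_cancel, sub_zero] at this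
  rw [← this]
  simp only [mul_comm]

/-- Proposition 4.11(i) (`thm:pair`(i)): for `k̲ ≤ a < y`, `Δ(a,a;y) = 0`,
the representation
`Δ(x,a;y) = ∫_{(0,x−a)} (q·v̲(x−z) − χ(x−z)) W^{(r+q)}(z) dz` holds for
`x ∈ (a,y)`, and `Δ(x,a;y) > 0` for all `x ∈ (a,y]`. -/
theorem stmt12
    (μ σ : ℝ) (ν : MeasureTheory.Measure ℝ)
    (hν : ν (Set.Ici 0) = 0)
    (hνint : ∫⁻ x, ENNReal.ofReal (min 1 (x ^ 2)) ∂ν ≠ ⊤)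
    (ψ : ℝ → ℝ)
    (hψ : ∀ β : ℝ, 0 ≤ β →
      ψ β = μ * β + σ ^ 2 / 2 * β ^ 2 +
        ∫ z, (Real.exp (β * z) - 1 -
          Set.indicator (Set.Ioi (-1 : ℝ)) (fun t => β * t) z) ∂ν)
    (Φ : ℝ → ℝ)
    (hΦ : ∀ s : ℝ, 0 ≤ s → 0 ≤ Φ s ∧ ψ (Φ s) = s ∧ ∀ β : ℝ, Φ s < β → s < ψ β)
    (r q : ℝ) (hr : 0 < r) (hq : 0 < q)
    (W : ℝ → ℝ → ℝ)
    (hWnn : ∀ s : ℝ, 0 ≤ s → ∀ x : ℝ, 0 ≤ W s x)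
    (hWzero : ∀ s : ℝ, 0 ≤ s → ∀ x : ℝ, x < 0 → W s x = 0)
    (hWpos : ∀ s : ℝ, 0 ≤ s → ∀ x : ℝ, 0 < x → 0 < W s x)
    (hWcont : ∀ s : ℝ, 0 ≤ s → ContinuousOn (W s) (Set.Ici 0))
    (hWmono : ∀ s : ℝ, 0 ≤ s → MonotoneOn (W s) (Set.Ici 0))
    (hWlap : ∀ s : ℝ, 0 ≤ s → ∀ β : ℝ, Φ s < β →
      ∫ x in Set.Ioi (0 : ℝ), Real.exp (-β * x) * W s x = 1 / (ψ β - s))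
    (hrψ : ψ 1 < r)
    (K : ℝ) (hK : 0 < K)
    (Kl kl : ℝ)
    (hKl : Kl = Φ (r + q) * K / (Φ (r + q) - 1))
    (hkl : kl = Real.log Kl)
    (v : ℝ → ℝ)
    (hv1 : ∀ x : ℝ, x ≤ kl → v x = (Kl - K) * Real.exp (Φ (r + q) * (x - kl)))
    (hv2 : ∀ x : ℝ, kl < x → v x = Real.exp x - K)
    (h : ℝ → ℝ) (hh : ∀ x : ℝ, h x = v x - (Real.exp x - K))
    (h' : ℝ → ℝ) (hh' : ∀ x : ℝ, HasDerivAt h (h' x) x)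
    (f : ℝ → ℝ)
    (hf : ∀ x : ℝ, kl ≤ x → f x = ∫ w in Set.Iio (kl - x), h (x + w) ∂ν)
    (χ : ℝ → ℝ)
    (hχ1 : ∀ x : ℝ, kl ≤ x → χ x = r * K - (r - ψ 1) * Real.exp x + f x)
    (hχ2 : ∀ x : ℝ, x < kl → χ x = q * v x)
    (y a : ℝ) (hay1 : kl ≤ a) (hay2 : a < y)
    (WW : ℝ → ℝ → ℝ)
    (hWW : ∀ x b : ℝ, WW x b =
      W (r + q) (x - b) - q * ∫ z in Set.Ioo y (max x y), W r (x - z) * W (r + q) (z - b))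
    (Δ : ℝ → ℝ → ℝ)
    (hΔ : ∀ x b : ℝ, Δ x b =
      (∫ w in Set.Ioo b y, WW x w * (q * v w - χ w)) -
        ∫ w in Set.Ico y (max x y), W r (x - w) * χ w) :
    Δ a a = 0 ∧
    (∀ x ∈ Set.Ioo a y,
      Δ x a = ∫ z in Set.Ioo 0 (x - a), (q * v (x - z) - χ (x - z)) * W (r + q) z) ∧
    (∀ x ∈ Set.Ioc a y, 0 < Δ x a) := by
  set p := Φ (r + q) with hp
  obtain ⟨hp0, hψp, hpgt⟩ := hΦ (r + q) (by positivity)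
  rw [← hp] at hp0 hψp hpgt
  have hp1 : 1 < p := by
    by_contra hc
    rcases (not_lt.mp hc).lt_or_eq with hlt | heq
    · linarith [hpgt 1 hlt]
    · rw [heq] at hψp
      linarith
  have hpne : p - 1 ≠ 0 := by linarith
  have hKl0 : 0 < Kl := by
    rw [hKl]
    exact div_pos (by positivity) (by linarith)
  have hAp : (Kl - K) * p = Kl := by
    have : Kl * (p - 1) = p * K := by
      rw [hKl]
      field_simp
    linarith
  have hekl : Real.exp kl = Kl := by rw [hkl, Real.exp_log hKl0]
  let k : ℝ → ℝ := fun t => (Kl - K) * Real.exp (p * t) - Kl * Real.exp t + K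
  have hk : Measurable k := by fun_prop
  have hkanti : AntitoneOn k (Set.Iic 0) := antitoneOn_exp_sub_exp hp1 hKl0 hAp
  have hknn : ∀ t ≤ 0, 0 ≤ k t := by
    intro t ht
    have h0 : k 0 = 0 := by simp [k]
    rw [← h0]
    exact hkanti ht Set.self_mem_Iic ht
  have hI1 := integrable_compensated_exp hν hνint zero_le_one
  have hIp := integrable_compensated_exp hν hνint hp0
  have hkeq : k = fun z => (Kl - K) * (Real.exp (p * z) - 1 -
        Set.indicator (Set.Ioi (-1 : ℝ)) (fun t => p * t) z) -
      Kl * (Real.exp (1 * z) - 1 - Set.indicator (Set.Ioi (-1 : ℝ)) (fun t => 1 * t) z) := by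
    funext z
    simp only [k, Set.indicator_apply, one_mul]
    split_ifs
    · linear_combination z * hAp
    · ring
  have hkint : Integrable k ν := by
    rw [hkeq]
    exact (hIp.const_mul _).sub (hI1.const_mul _)
  have hkval : ∫ z, k z ∂ν = (Kl - K) * (r + q) - Kl * ψ 1 - σ ^ 2 / 2 * (Kl * (p - 1)) := by
    rw [hkeq, integral_sub (hIp.const_mul _) (hI1.const_mul _), integral_const_mul,
      integral_const_mul]
    have e1 := hψ p hp0
    rw [hψp] at e1
    have e2 := hψ 1 zero_le_one
    linear_combination -(Kl - K) * e1 + Kl * e2 - (μ + σ ^ 2 / 2 * p) * hAp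
  have hF := antitoneOn_integral_overshoot hk hkanti hknn hkint
  have hF0 : ∫ w in Set.Iio (-(0 : ℝ)), k (0 + w) ∂ν = ∫ z, k z ∂ν := by
    simp only [zero_add, neg_zero]
    rw [← Set.compl_Ici, Measure.restrict_eq_self_of_ae_mem]
    rw [ae_iff]
    simpa [Set.Ici] using hν
  have hfF : ∀ x, kl ≤ x → f x = ∫ w in Set.Iio (-(x - kl)), k ((x - kl) + w) ∂ν := by
    intro x hx
    rw [hf x hx, neg_sub]
    refine setIntegral_congr_fun measurableSet_Iio ?_
    intro w hw
    have hw' : w < kl - x := hw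
    simp only [k]
    rw [hh, hv1 _ (by linarith)]
    have : Real.exp (x + w) = Kl * Real.exp (x - kl + w) := by
      rw [← hekl, ← Real.exp_add]
      congr 1
      ring
    rw [this, show x + w - kl = x - kl + w by ring]
    ring
  have hfanti : AntitoneOn f (Set.Ici kl) := by
    intro s hs t ht hst
    have hs' : kl ≤ s := hs
    have ht' : kl ≤ t := ht
    rw [hfF s hs', hfF t ht']
    exact hF (Set.mem_Ici.mpr (by linarith)) (Set.mem_Ici.mpr (by linarith)) (by linarith)
  have hfkl : f kl ≤ (Kl - K) * (r + q) - Kl * ψ 1 := by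
    rw [hfF kl le_rfl, sub_self, hF0, hkval]
    have : 0 ≤ σ ^ 2 / 2 * (Kl * (p - 1)) :=
      mul_nonneg (by positivity) (mul_nonneg hKl0.le (by linarith))
    linarith
  have hv : ∀ x, kl ≤ x → v x = Real.exp x - K := by
    intro x hx
    rcases hx.eq_or_lt with rfl | hlt
    · rw [hv1 _ le_rfl, sub_self, mul_zero, Real.exp_zero, hekl, mul_one]
    · exact hv2 x hlt
  let g : ℝ → ℝ := fun x => q * v x - χ x
  have hg : ∀ x, kl ≤ x → g x = (r + q - ψ 1) * Real.exp x - (r + q) * K - f x := by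
    intro x hx
    simp only [g]
    rw [hv x hx, hχ1 x hx]
    ring
  have hgmono : MonotoneOn g (Set.Ici kl) := by
    intro s hs t ht hst
    rw [hg s hs, hg t ht]
    have h1 := hfanti hs ht hst
    have h2 := Real.exp_le_exp.mpr hst
    nlinarith
  have hgpos : ∀ x, kl < x → 0 < g x := by
    intro x hx
    rw [hg x hx.le]
    have h1 := hfanti Set.self_mem_Ici (Set.mem_Ici.mpr hx.le) hx.le
    have h2 := Real.exp_lt_exp.mpr hx
    rw [hekl] at h2
    nlinarith
  have hrq : 0 ≤ r + q := by positivity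
  have hrep : ∀ x, a ≤ x → x ≤ y →
      Δ x a = ∫ z in (0 : ℝ)..(x - a), g (x - z) * W (r + q) z := by
    intro x hax hxy
    rw [hΔ, max_eq_right hxy, ← setIntegral_kernel_sub (hWzero _ hrq) hax hxy]
    simp only [hWW, max_eq_right hxy, Set.Ico_self, Set.Ioo_self, Measure.restrict_empty,
      integral_zero_measure, mul_zero, sub_zero, g]
  refine ⟨?_, ?_, ?_⟩
  · rw [hrep a le_rfl hay2.le, sub_self, intervalIntegral.integral_same]
  · rintro x ⟨hax, hxy⟩
    rw [hrep x hax.le hxy.le, intervalIntegral.integral_of_le (by linarith),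
      integral_Ioc_eq_integral_Ioo]
  · rintro x ⟨hax, hxy⟩
    rw [hrep x hax.le hxy]
    have hle : (0 : ℝ) ≤ x - a := by linarith
    refine intervalIntegral.intervalIntegral_pos_of_pos_on ?_ ?_ (by linarith)
    · refine IntervalIntegrable.mul_continuousOn (AntitoneOn.intervalIntegrable ?_) ?_
      · rw [Set.uIcc_of_le hle]
        rintro s ⟨-, hs⟩ t ⟨-, ht⟩ hst
        exact hgmono (Set.mem_Ici.mpr (by linarith)) (Set.mem_Ici.mpr (by linarith))
          (by linarith)
      · rw [Set.uIcc_of_le hle]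
        exact (hWcont _ hrq).mono Set.Icc_subset_Ici_self
    · rintro z ⟨hz0, hz1⟩
      exact mul_pos (hgpos _ (by linarith)) (hWpos _ hrq z hz0)
end

section
/- Fix k̲ ≤ a < y < x. Then the derivative of Δ(x, a; y) with respect to the level y (which enters both through W^{(r,q)} and through the domains of integration) equals q·W^{(r)}(x − y)·( v̲(y) + Δ(y, a; y) ), and this quantity is strictly positive; in particular y ↦ Δ(x, a; y) is strictly increasing on (a, x). -/
open MeasureTheory Real Set Filter Topology

lemma integral_comp_exp_neg_mul_eq_zero {G : ℝ → ℝ} (hG : IntegrableOn G (Ioi 0))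
    (hmom : ∀ n : ℕ, ∫ x in Ioi (0 : ℝ), exp (-x) ^ n * G x = 0)
    {φ : ℝ → ℝ} (hφ : Continuous φ) :
    ∫ x in Ioi (0 : ℝ), φ (exp (-x)) * G x = 0 := by
  have hmem : ∀ x ∈ Ioi (0 : ℝ), exp (-x) ∈ Icc (0 : ℝ) 1 := fun x hx =>
    ⟨(exp_pos _).le, exp_le_one_iff.2 (by simpa using (mem_Ioi.1 hx).le)⟩
  have hint : ∀ θ : ℝ → ℝ, Continuous θ →
      IntegrableOn (fun x => θ (exp (-x)) * G x) (Ioi 0) := by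
    intro θ hθ
    obtain ⟨C, hC⟩ := isCompact_Icc.exists_bound_of_continuousOn
      (hθ.continuousOn (s := Icc (0 : ℝ) 1))
    refine Integrable.bdd_mul (c := C) hG (by fun_prop : Continuous _).aestronglyMeasurable ?_
    filter_upwards [ae_restrict_mem measurableSet_Ioi] with x hx using hC _ (hmem x hx)
  have hpoly : ∀ p : Polynomial ℝ, ∫ x in Ioi (0 : ℝ), p.eval (exp (-x)) * G x = 0 := by
    intro p
    simp only [Polynomial.eval_eq_sum_range, Finset.sum_mul]
    rw [integral_finsetSum]
    · refine Finset.sum_eq_zero fun n _ => ?_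
      simp only [mul_assoc]
      rw [integral_const_mul, hmom, mul_zero]
    · intro n _
      exact hint (fun u => p.coeff n * u ^ n) (by fun_prop)
  by_contra hne
  have hA : 0 ≤ ∫ x in Ioi (0 : ℝ), ‖G x‖ := integral_nonneg fun _ => norm_nonneg _
  set A := ∫ x in Ioi (0 : ℝ), ‖G x‖
  set I := ∫ x in Ioi (0 : ℝ), φ (exp (-x)) * G x
  have hI : 0 < |I| := abs_pos.2 hne
  obtain ⟨p, hp⟩ := exists_polynomial_near_of_continuousOn 0 1 φ hφ.continuousOn
    (|I| / (A + 1)) (by positivity)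
  have hle : |I| ≤ |I| / (A + 1) * A := by
    have hsub : I = ∫ x in Ioi (0 : ℝ), (φ (exp (-x)) - p.eval (exp (-x))) * G x := by
      simp only [sub_mul]
      rw [integral_sub (hint φ hφ) (hint _ p.continuous), hpoly, sub_zero]
    rw [← Real.norm_eq_abs I]
    conv_lhs => rw [hsub]
    rw [← integral_const_mul]
    refine norm_integral_le_of_norm_le (hG.norm.const_mul _) ?_
    filter_upwards [ae_restrict_mem measurableSet_Ioi] with x hx
    rw [norm_mul]
    gcongr
    rw [Real.norm_eq_abs, abs_sub_comm]
    exact (hp _ (hmem x hx)).le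
  have hlt : |I| / (A + 1) * A < |I| := by
    rw [div_mul_eq_mul_div, div_lt_iff₀ (by positivity)]
    nlinarith
  exact absurd hle (not_le.2 hlt)

/-- A continuous function on `(0, ∞)` whose Laplace transform vanishes along `β + ℕ` is zero. -/
lemma eq_zero_of_laplace_eq_zero {F : ℝ → ℝ} (hF : Continuous F) (β : ℝ)
    (hint : IntegrableOn (fun x => exp (-β * x) * F x) (Ioi 0))
    (hlap : ∀ n : ℕ, ∫ x in Ioi (0 : ℝ), exp (-(β + n) * x) * F x = 0) :
    ∀ x : ℝ, 0 < x → F x = 0 := by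
  have hmom : ∀ n : ℕ, ∫ x in Ioi (0 : ℝ), exp (-x) ^ n * (exp (-β * x) * F x) = 0 := by
    intro n
    have (x : ℝ) : exp (-x) ^ n * (exp (-β * x) * F x) = exp (-(β + n) * x) * F x := by
      rw [← exp_nat_mul, ← mul_assoc, ← exp_add]
      ring_nf
    simpa only [this] using hlap n
  have hae : ∀ᵐ x, x ∈ Ioi (0 : ℝ) → exp (-β * x) * F x = 0 := by
    refine IsOpen.ae_eq_zero_of_integral_contDiff_smul_eq_zero isOpen_Ioi
      hint.locallyIntegrableOn fun g hg hgc hgU => ?_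
    have hφ : Continuous fun u : ℝ => g (-log u) := by
      rw [continuous_iff_continuousAt]
      intro u
      rcases eq_or_ne u 0 with rfl | hu
      · have hg0 : g (-log 0) = 0 := by
          simp only [log_zero, neg_zero]
          exact image_eq_zero_of_notMem_tsupport fun h0 => lt_irrefl (0 : ℝ) (hgU h0)
        rw [continuousAt_iff_punctured_nhds, hg0]
        exact (hgc.is_zero_at_infty.mono_left atTop_le_cocompact).comp
          (tendsto_neg_atBot_atTop.comp tendsto_log_nhdsNE_zero)
      · exact hg.continuous.continuousAt.comp (continuousAt_log hu).neg
    have := integral_comp_exp_neg_mul_eq_zero hint hmom hφ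
    simp only [log_exp, neg_neg] at this
    rw [← this]
    simp only [smul_eq_mul]
    refine (setIntegral_eq_integral_of_forall_compl_eq_zero fun x hx => ?_).symm
    rw [image_eq_zero_of_notMem_tsupport fun h => hx (hgU h), zero_mul]
  have hae' : (fun x => F x) =ᵐ[volume.restrict (Ioi (0 : ℝ))] fun _ => 0 := by
    rw [EventuallyEq, ae_restrict_iff' measurableSet_Ioi]
    filter_upwards [hae] with x hx hx0
    exact (mul_eq_zero.1 (hx hx0)).resolve_left (exp_ne_zero _)
  exact fun x hx => Measure.eqOn_open_of_ae_eq hae' isOpen_Ioi hF.continuousOn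
    continuousOn_const hx

/-- If `A`, `B` have Laplace transforms `1 / (ψ - r)`, `1 / (ψ - (r + q))` beyond `b`, then
`B - A = q (A * B)`. -/
lemma resolvent_identity {A B ψ : ℝ → ℝ} {r q b : ℝ} (hA : Continuous A) (hB : Continuous B)
    (hq : 0 < q) (hψ : ∀ β, b < β → r + q < ψ β)
    (hAlap : ∀ β, b < β → ∫ x in Ioi (0 : ℝ), exp (-β * x) * A x = 1 / (ψ β - r))
    (hBlap : ∀ β, b < β → ∫ x in Ioi (0 : ℝ), exp (-β * x) * B x = 1 / (ψ β - (r + q)))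
    {x : ℝ} (hx : 0 < x) :
    B x = A x + q * ∫ t in (0 : ℝ)..x, A t * B (x - t) := by
  have hAint : ∀ β, b < β → IntegrableOn (fun x => exp (-β * x) * A x) (Ioi 0) := by
    intro β hβ
    refine not_imp_comm.1 integral_undef ?_
    rw [hAlap β hβ]
    have := hψ β hβ
    exact one_div_ne_zero (by linarith)
  have hBint : ∀ β, b < β → IntegrableOn (fun x => exp (-β * x) * B x) (Ioi 0) := by
    intro β hβ
    refine not_imp_comm.1 integral_undef ?_
    rw [hBlap β hβ]
    have := hψ β hβ
    exact one_div_ne_zero (by linarith)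
  have hconv : ∀ β x : ℝ, ∫ t in (0 : ℝ)..x,
      (ContinuousLinearMap.mul ℝ ℝ) (exp (-β * t) * A t) (exp (-β * (x - t)) * B (x - t)) =
      exp (-β * x) * ∫ t in (0 : ℝ)..x, A t * B (x - t) := by
    intro β x
    rw [← intervalIntegral.integral_const_mul]
    refine intervalIntegral.integral_congr fun t _ => ?_
    simp only [ContinuousLinearMap.mul_apply']
    have : exp (-β * x) = exp (-β * t) * exp (-β * (x - t)) := by
      rw [← exp_add]; ring_nf
    rw [this]; ring
  have hCint : ∀ β, b < β → IntegrableOn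
      (fun x => exp (-β * x) * ∫ t in (0 : ℝ)..x, A t * B (x - t)) (Ioi 0) := by
    intro β hβ
    have := integrable_posConvolution (hAint β hβ) (hBint β hβ) (ContinuousLinearMap.mul ℝ ℝ)
    rw [posConvolution, integrable_indicator_iff measurableSet_Ioi] at this
    simpa only [hconv] using this
  have hClap : ∀ β, b < β →
      ∫ x in Ioi (0 : ℝ), exp (-β * x) * ∫ t in (0 : ℝ)..x, A t * B (x - t) =
      1 / (ψ β - r) * (1 / (ψ β - (r + q))) := by
    intro β hβ
    have := integral_posConvolution (hAint β hβ) (hBint β hβ) (ContinuousLinearMap.mul ℝ ℝ)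
    simp only [hconv] at this
    rw [this, hAlap β hβ, hBlap β hβ, ContinuousLinearMap.mul_apply']
  have hCcont : Continuous fun x => ∫ t in (0 : ℝ)..x, A t * B (x - t) :=
    intervalIntegral.continuous_parametric_intervalIntegral_of_continuous
      (f := fun x t => A t * B (x - t)) (by unfold Function.uncurry; fun_prop) continuous_id
  have hlap : ∀ n : ℕ, b < b + 1 + n := fun n => by
    have : (0 : ℝ) ≤ n := n.cast_nonneg
    linarith
  have hb : b < b + 1 := by linarith
  have key := eq_zero_of_laplace_eq_zero
    (F := fun x => B x - A x - q * ∫ t in (0 : ℝ)..x, A t * B (x - t)) (by fun_prop) (b + 1)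
    (by
      refine (((hBint _ hb).sub (hAint _ hb)).sub ((hCint _ hb).const_mul q)).congr
        (Eventually.of_forall fun x => ?_)
      simp only [Pi.sub_apply]
      ring)
    (by
      intro n
      have h1 := hBint _ (hlap n)
      have h2 := hAint _ (hlap n)
      have h12 : IntegrableOn (fun x =>
          exp (-(b + 1 + n) * x) * B x - exp (-(b + 1 + n) * x) * A x) (Ioi 0) := h1.sub h2
      have h3 := (hCint _ (hlap n)).const_mul q
      have : ∀ x, exp (-(b + 1 + n) * x) *
            (B x - A x - q * ∫ t in (0 : ℝ)..x, A t * B (x - t)) =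
          (exp (-(b + 1 + n) * x) * B x - exp (-(b + 1 + n) * x) * A x) -
            q * (exp (-(b + 1 + n) * x) * ∫ t in (0 : ℝ)..x, A t * B (x - t)) :=
        fun x => by ring
      simp only [this]
      rw [integral_sub h12 h3, integral_sub h1 h2, integral_const_mul,
        hAlap _ (hlap n), hBlap _ (hlap n), hClap _ (hlap n)]
      have := hψ _ (hlap n)
      have h4 : ψ (b + 1 + n) - (r + q) ≠ 0 := by linarith
      have h5 : ψ (b + 1 + n) - r ≠ 0 := by linarith
      field_simp
      ring) x hx
  linarith

lemma integral_triangle_swap {F : ℝ → ℝ → ℝ} (hF : Continuous (Function.uncurry F))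
    {a t : ℝ} (hat : a ≤ t) :
    ∫ w in a..t, ∫ z in w..t, F w z = ∫ z in a..t, ∫ w in a..z, F w z := by
  have hI : IntegrableOn (Function.uncurry F) (Ioc a t ×ˢ Ioc a t) (volume.prod volume) :=
    (hF.continuousOn.integrableOn_compact (isCompact_Icc.prod isCompact_Icc)).mono_set
      (prod_mono Ioc_subset_Icc_self Ioc_subset_Icc_self)
  have hT : MeasurableSet {p : ℝ × ℝ | p.1 < p.2} := measurableSet_lt measurable_fst measurable_snd
  have hI' := hI.indicator hT
  rw [IntegrableOn, ← Measure.prod_restrict] at hI'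
  have hswap := integral_integral_swap
    (f := fun w z => {p : ℝ × ℝ | p.1 < p.2}.indicator (Function.uncurry F) (w, z)) hI'
  rw [intervalIntegral.integral_of_le hat, intervalIntegral.integral_of_le hat]
  convert hswap using 1
  · refine setIntegral_congr_fun measurableSet_Ioc fun w hw => ?_
    rw [intervalIntegral.integral_of_le hw.2]
    have : ∀ z, {p : ℝ × ℝ | p.1 < p.2}.indicator (Function.uncurry F) (w, z) =
        (Ioi w).indicator (F w) z := fun z => by simp [indicator, Function.uncurry]
    simp only [this]
    rw [setIntegral_indicator measurableSet_Ioi, Ioc_inter_Ioi, max_eq_right hw.1.le]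
  · refine setIntegral_congr_fun measurableSet_Ioc fun z hz => ?_
    rw [intervalIntegral.integral_of_le hz.1.le, integral_Ioc_eq_integral_Ioo]
    have : ∀ w, {p : ℝ × ℝ | p.1 < p.2}.indicator (Function.uncurry F) (w, z) =
        (Iio z).indicator (fun w => F w z) w := fun w => by simp [indicator, Function.uncurry]
    simp only [this]
    rw [setIntegral_indicator measurableSet_Iio]
    congr 2
    ext w
    simp only [mem_Ioo, mem_inter_iff, mem_Ioc, mem_Iio]
    exact ⟨fun h => ⟨⟨h.1, h.2.le.trans hz.2⟩, h.2⟩, fun h => ⟨h.1.1, h.2⟩⟩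

lemma integrable_levy_exponent_integrand {ν : Measure ℝ} (hν : ν (Ici 0) = 0)
    (hνint : ∫⁻ x, ENNReal.ofReal (min 1 (x ^ 2)) ∂ν ≠ ⊤) {β : ℝ} (hβ : 0 ≤ β) :
    Integrable (fun z => exp (β * z) - 1 - indicator (Ioi (-1 : ℝ)) (fun t => β * t) z) ν := by
  have hmin : Integrable (fun x : ℝ => min 1 (x ^ 2)) ν := by
    refine ⟨(by fun_prop : Continuous _).aestronglyMeasurable, ?_⟩
    rw [hasFiniteIntegral_iff_ofReal (Eventually.of_forall fun x => by positivity)]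
    exact hνint.lt_top
  refine (hmin.const_mul (1 + β ^ 2)).mono' (Measurable.aestronglyMeasurable ?_) ?_
  · exact (by fun_prop : Measurable fun z : ℝ => exp (β * z) - 1).sub
      ((by fun_prop : Measurable fun t : ℝ => β * t).indicator measurableSet_Ioi)
  have hneg : ∀ᵐ z ∂ν, z ∉ Ici (0 : ℝ) := measure_eq_zero_iff_ae_notMem.1 hν
  filter_upwards [hneg] with z hz
  have hz : z < 0 := not_le.1 hz
  have hu : β * z ≤ 0 := mul_nonpos_of_nonneg_of_nonpos hβ hz.le
  rw [Real.norm_eq_abs]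
  by_cases h1 : -1 < z
  · rw [indicator_of_mem (mem_Ioi.2 h1), min_eq_right (by nlinarith)]
    refine le_trans ?_ (by nlinarith [sq_nonneg z] : (β * z) ^ 2 ≤ (1 + β ^ 2) * z ^ 2)
    by_cases h2 : -1 ≤ β * z
    · exact abs_exp_sub_one_sub_id_le (abs_le.2 ⟨h2, by linarith⟩)
    · have := add_one_le_exp (β * z)
      have h3 : exp (β * z) ≤ 1 := exp_le_one_iff.2 hu
      rw [abs_of_nonneg (by linarith)]
      nlinarith
  · rw [indicator_of_notMem (by simpa using h1), min_eq_left (by nlinarith)]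
    have h3 : exp (β * z) ≤ 1 := exp_le_one_iff.2 hu
    have := exp_pos (β * z)
    rw [abs_le]
    constructor <;> nlinarith [sq_nonneg β]

lemma antitoneOn_smooth_fit_gap {Φ c K : ℝ} (hΦ : 1 < Φ) (hc : 0 ≤ c) :
    AntitoneOn (fun u => c / Φ * exp (Φ * u) - c * exp u + K) (Iic 0) := by
  have hd : ∀ u, HasDerivAt (fun u => c / Φ * exp (Φ * u) - c * exp u + K)
      (c / Φ * (exp (Φ * u) * (Φ * 1)) - c * exp u) u := fun u =>
    ((((hasDerivAt_id u).const_mul Φ).exp.const_mul (c / Φ)).sub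
      ((hasDerivAt_exp u).const_mul c)).add_const K
  refine antitoneOn_of_deriv_nonpos (convex_Iic 0)
    (fun u _ => (hd u).continuousAt.continuousWithinAt)
    (fun u _ => (hd u).differentiableAt.differentiableWithinAt) fun u hu => ?_
  rw [interior_Iic] at hu
  rw [(hd u).deriv]
  have h1 : c / Φ * (exp (Φ * u) * (Φ * 1)) = c * exp (Φ * u) := by field_simp
  have h2 : exp (Φ * u) ≤ exp u := exp_le_exp.2 (by nlinarith [mem_Iio.1 hu])
  rw [h1]
  nlinarith

/-- The jump part `∫ h(x + w) ν(dw)` of the generator is continuous and antitone in `x`. -/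
lemma continuous_antitone_integral_translate {ν : Measure ℝ} {h : ℝ → ℝ} {c : ℝ}
    (hcont : Continuous h) (hanti : Antitone h) (hnn : ∀ x, 0 ≤ h x)
    (hint : Integrable (fun w => h (c + w)) ν) :
    Continuous (fun x => ∫ w, h (max x c + w) ∂ν) ∧
      Antitone (fun x => ∫ w, h (max x c + w) ∂ν) := by
  have hle : ∀ x w, h (max x c + w) ≤ h (c + w) := fun x w =>
    hanti (by linarith [le_max_right x c])
  have hmeas : ∀ x, AEStronglyMeasurable (fun w => h (max x c + w)) ν := fun x =>
    (by fun_prop : Continuous fun w => h (max x c + w)).aestronglyMeasurable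
  have hnorm : ∀ x, ∀ᵐ w ∂ν, ‖h (max x c + w)‖ ≤ h (c + w) := fun x =>
    Eventually.of_forall fun w => by
      rw [Real.norm_eq_abs, abs_of_nonneg (hnn _)]
      exact hle x w
  refine ⟨continuous_of_dominated hmeas hnorm hint (Eventually.of_forall fun w => by fun_prop),
    fun x y hxy => integral_mono (hint.mono' (hmeas y) (hnorm y)) (hint.mono' (hmeas x) (hnorm x))
      fun w => hanti ?_⟩
  have := max_le_max_right c hxy
  linarith

/-- Display (4.34) (`eq:Ddev`): for `k̲ ≤ a < y < x`, the derivative of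
`Δ(x,a;y)` with respect to the level `y` equals
`q·W^{(r)}(x−y)·(v̲(y) + Δ(y,a;y)) > 0`; in particular `y ↦ Δ(x,a;y)` is
strictly increasing on `(a, x)`. -/
theorem stmt14
    (μ σ : ℝ) (ν : MeasureTheory.Measure ℝ)
    (hν : ν (Set.Ici 0) = 0)
    (hνint : ∫⁻ x, ENNReal.ofReal (min 1 (x ^ 2)) ∂ν ≠ ⊤)
    (ψ : ℝ → ℝ)
    (hψ : ∀ β : ℝ, 0 ≤ β →
      ψ β = μ * β + σ ^ 2 / 2 * β ^ 2 +
        ∫ z, (Real.exp (β * z) - 1 -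
          Set.indicator (Set.Ioi (-1 : ℝ)) (fun t => β * t) z) ∂ν)
    (Φ : ℝ → ℝ)
    (hΦ : ∀ s : ℝ, 0 ≤ s → 0 ≤ Φ s ∧ ψ (Φ s) = s ∧ ∀ β : ℝ, Φ s < β → s < ψ β)
    (r q : ℝ) (hr : 0 < r) (hq : 0 < q)
    (W : ℝ → ℝ → ℝ)
    (hWnn : ∀ s : ℝ, 0 ≤ s → ∀ x : ℝ, 0 ≤ W s x)
    (hWzero : ∀ s : ℝ, 0 ≤ s → ∀ x : ℝ, x < 0 → W s x = 0)
    (hWpos : ∀ s : ℝ, 0 ≤ s → ∀ x : ℝ, 0 < x → 0 < W s x)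
    (hWcont : ∀ s : ℝ, 0 ≤ s → ContinuousOn (W s) (Set.Ici 0))
    (hWmono : ∀ s : ℝ, 0 ≤ s → MonotoneOn (W s) (Set.Ici 0))
    (hWlap : ∀ s : ℝ, 0 ≤ s → ∀ β : ℝ, Φ s < β →
      ∫ x in Set.Ioi (0 : ℝ), Real.exp (-β * x) * W s x = 1 / (ψ β - s))
    (hrψ : ψ 1 < r)
    (K : ℝ) (hK : 0 < K)
    (Kl kl : ℝ)
    (hKl : Kl = Φ (r + q) * K / (Φ (r + q) - 1))
    (hkl : kl = Real.log Kl)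
    (v : ℝ → ℝ)
    (hv1 : ∀ x : ℝ, x ≤ kl → v x = (Kl - K) * Real.exp (Φ (r + q) * (x - kl)))
    (hv2 : ∀ x : ℝ, kl < x → v x = Real.exp x - K)
    (h : ℝ → ℝ) (hh : ∀ x : ℝ, h x = v x - (Real.exp x - K))
    (h' : ℝ → ℝ) (hh' : ∀ x : ℝ, HasDerivAt h (h' x) x)
    (f : ℝ → ℝ)
    (hf : ∀ x : ℝ, kl ≤ x → f x = ∫ w in Set.Iio (kl - x), h (x + w) ∂ν)
    (χ : ℝ → ℝ)
    (hχ1 : ∀ x : ℝ, kl ≤ x → χ x = r * K - (r - ψ 1) * Real.exp x + f x)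
    (hχ2 : ∀ x : ℝ, x < kl → χ x = q * v x)
    (WWL : ℝ → ℝ → ℝ → ℝ)
    (hWWL : ∀ t x' b : ℝ, WWL t x' b =
      W (r + q) (x' - b) - q * ∫ z in Set.Ioo t (max x' t), W r (x' - z) * W (r + q) (z - b))
    (ΔL : ℝ → ℝ → ℝ → ℝ)
    (hΔL : ∀ t x' b : ℝ, ΔL t x' b =
      (∫ w in Set.Ioo b t, WWL t x' w * (q * v w - χ w)) -
        ∫ w in Set.Ico t (max x' t), W r (x' - w) * χ w)
    (a y x : ℝ) (ha : kl ≤ a) (hay : a < y) (hyx : y < x) :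
    HasDerivAt (fun t => ΔL t x a) (q * W r (x - y) * (v y + ΔL y y a)) y ∧
    0 < q * W r (x - y) * (v y + ΔL y y a) ∧
    StrictMonoOn (fun t => ΔL t x a) (Set.Ioo a x) := by
  obtain ⟨-, hψp, hΦtop⟩ := hΦ (r + q) (by positivity)
  have hr0 : 0 ≤ r := hr.le
  have hp0 : 0 ≤ r + q := by positivity
  have hΦ1 : 1 < Φ (r + q) := by
    by_contra! hle
    rcases hle.lt_or_eq with hlt | heq
    · linarith [hΦtop 1 hlt]
    · rw [heq] at hψp
      linarith
  set p := Φ (r + q) with hpdef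
  have hppos : 0 < p := by linarith
  have hp1 : p - 1 ≠ 0 := by linarith
  have hKlpos : 0 < Kl := by
    rw [hKl]
    exact div_pos (mul_pos hppos hK) (by linarith)
  have hKlK : Kl - K = Kl / p := by
    rw [hKl]
    field_simp
    ring
  have hexpkl : exp kl = Kl := by rw [hkl, exp_log hKlpos]
  have hv : ∀ x, kl ≤ x → v x = exp x - K := by
    intro x hx
    rcases hx.eq_or_lt with rfl | hx
    · rw [hv1 _ le_rfl, hexpkl]
      simp
    · exact hv2 x hx
  have hh_eq : ∀ x, h x = Kl / p * exp (p * min (x - kl) 0) - Kl * exp (min (x - kl) 0) + K := by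
    intro x
    rcases le_total x kl with hx | hx
    · rw [hh, hv1 x hx, min_eq_left (by linarith), hKlK, exp_sub x kl, hexpkl]
      field_simp
      ring
    · rw [hh, hv x hx, min_eq_right (by linarith), ← hKlK]
      simp
  have hh_anti : Antitone h := fun x z hxz => by
    rw [hh_eq, hh_eq]
    exact antitoneOn_smooth_fit_gap hΦ1 hKlpos.le (mem_Iic.2 (min_le_right _ _))
      (mem_Iic.2 (min_le_right _ _))
      (min_le_min_right _ (by linarith))
  have hh_cont : Continuous h := by
    rw [funext hh_eq]
    fun_prop
  have hh_zero : ∀ x, kl ≤ x → h x = 0 := fun x hx => by rw [hh, hv x hx, sub_self]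
  have hh_nn : ∀ x, 0 ≤ h x := fun x => by
    rw [← hh_zero _ (le_max_right x kl)]
    exact hh_anti (le_max_left x kl)
  -- the jump integral at `kl`, in terms of the Laplace exponent
  have hI1 := integrable_levy_exponent_integrand hν hνint (zero_le_one (α := ℝ))
  have hIp := integrable_levy_exponent_integrand hν hνint hppos.le
  have hneg : ∀ᵐ z ∂ν, z ∉ Ici (0 : ℝ) := measure_eq_zero_iff_ae_notMem.1 hν
  have hjump : (fun z => Kl / p * (exp (p * z) - 1 - indicator (Ioi (-1 : ℝ)) (fun t => p * t) z) -
      Kl * (exp (1 * z) - 1 - indicator (Ioi (-1 : ℝ)) (fun t => 1 * t) z))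
      =ᵐ[ν] fun w => h (kl + w) := by
    filter_upwards [hneg] with z hz
    have hz : z ≤ 0 := (not_le.1 hz).le
    have hK' : K = Kl - Kl / p := by linarith
    rw [hh_eq, add_sub_cancel_left, min_eq_left hz]
    by_cases hz1 : z ∈ Ioi (-1 : ℝ)
    · rw [indicator_of_mem hz1, indicator_of_mem hz1, hK']
      field_simp
      ring_nf
    · rw [indicator_of_notMem hz1, indicator_of_notMem hz1, hK']
      ring_nf
  have hhint : Integrable (fun w => h (kl + w)) ν :=
    ((hIp.const_mul _).sub (hI1.const_mul _)).congr hjump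
  have hfkl : ∫ w, h (kl + w) ∂ν =
      Kl / p * (r + q - μ * p - σ ^ 2 / 2 * p ^ 2) - Kl * (ψ 1 - μ - σ ^ 2 / 2) := by
    rw [← integral_congr_ae hjump, integral_sub (hIp.const_mul _) (hI1.const_mul _),
      integral_const_mul, integral_const_mul, ← hψp, hψ p hppos.le, hψ 1 zero_le_one]
    ring
  obtain ⟨hJcont, hJanti⟩ := continuous_antitone_integral_translate hh_cont hh_anti hh_nn hhint
  have hf_eq : ∀ x, kl ≤ x → f x = ∫ w, h (max x kl + w) ∂ν := by
    intro x hx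
    rw [hf x hx, max_eq_left hx]
    refine setIntegral_eq_integral_of_forall_compl_eq_zero fun w hw => hh_zero _ ?_
    linarith [notMem_Iio.1 hw]
  -- continuous extensions of the data
  obtain ⟨C, hCdef⟩ : ∃ C : ℝ → ℝ, C = fun x =>
    r * K - (r - ψ 1) * exp x + ∫ w, h (max x kl + w) ∂ν := ⟨_, rfl⟩
  obtain ⟨G, hGdef⟩ : ∃ G : ℝ → ℝ, G = fun x => q * (exp x - K) - C x := ⟨_, rfl⟩
  have hCc : Continuous C := by
    rw [hCdef]
    fun_prop
  have hGc : Continuous G := by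
    rw [hGdef]
    fun_prop
  have hC : ∀ x, kl ≤ x → χ x = C x := fun x hx => by rw [hχ1 x hx, hf_eq x hx, hCdef]
  have hG : ∀ x, kl ≤ x → q * v x - χ x = G x := fun x hx => by rw [hv x hx, hC x hx, hGdef]
  have hGnn : ∀ x, kl ≤ x → 0 ≤ G x := by
    intro x hx
    have h1 := hJanti hx
    simp only [max_self] at h1
    rw [hfkl] at h1
    have h2 : Kl ≤ exp x := hexpkl ▸ exp_le_exp.2 hx
    have h3 : (r + q - ψ 1) * Kl ≤ (r + q - ψ 1) * exp x :=
      mul_le_mul_of_nonneg_left h2 (by linarith)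
    have h4 : (r + q - ψ 1) * Kl - (r + q) * K - (Kl / p * (r + q - μ * p - σ ^ 2 / 2 * p ^ 2) -
        Kl * (ψ 1 - μ - σ ^ 2 / 2)) = σ ^ 2 / 2 * Kl * (p - 1) := by
      have hK' : K = Kl - Kl / p := by linarith
      rw [hK']
      field_simp
      ring
    have h5 : 0 ≤ σ ^ 2 / 2 * Kl * (p - 1) :=
      mul_nonneg (by positivity) (by linarith)
    rw [hGdef, hCdef]
    simp only
    linarith
  have hext : ∀ s, 0 ≤ s → Continuous fun u => W s (max u 0) := fun s hs =>
    (hWcont s hs).comp_continuous (by fun_prop) fun u => le_max_right u 0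
  obtain ⟨A, hAdef⟩ : ∃ A : ℝ → ℝ, A = fun u => W r (max u 0) := ⟨_, rfl⟩
  obtain ⟨B, hBdef⟩ : ∃ B : ℝ → ℝ, B = fun u => W (r + q) (max u 0) := ⟨_, rfl⟩
  have hAc : Continuous A := hAdef ▸ hext r hr0
  have hBc : Continuous B := hBdef ▸ hext (r + q) hp0
  have hA : ∀ u, 0 ≤ u → W r u = A u := fun u hu => by simp only [hAdef, max_eq_left hu]
  have hB : ∀ u, 0 ≤ u → W (r + q) u = B u := fun u hu => by simp only [hBdef, max_eq_left hu]
  have hlap : ∀ s, 0 ≤ s → ∀ β, Φ s < β →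
      ∫ x in Ioi (0 : ℝ), exp (-β * x) * W s (max x 0) = 1 / (ψ β - s) := fun s hs β hβ => by
    rw [← hWlap s hs β hβ]
    refine setIntegral_congr_fun measurableSet_Ioi fun x hx => ?_
    simp only [max_eq_left (mem_Ioi.1 hx).le]
  have hres : ∀ u, 0 < u → B u = A u + q * ∫ t in (0 : ℝ)..u, A t * B (u - t) := fun u hu =>
    resolvent_identity (ψ := ψ) (b := max (Φ r) p) hAc hBc hq
      (fun β hβ => hΦtop β ((le_max_right _ _).trans_lt hβ))
      (fun β hβ => by rw [hAdef]; exact hlap r hr0 β ((le_max_left _ _).trans_lt hβ))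
      (fun β hβ => by rw [hBdef]; exact hlap (r + q) hp0 β ((le_max_right _ _).trans_lt hβ)) hu
  have hWWL_eq : ∀ t ∈ Ioo a x, ∀ w ∈ Ioo a t,
      WWL t x w = A (x - w) + q * ∫ z in w..t, A (x - z) * B (z - w) := by
    intro t ht w hw
    have hconv : ∫ s in (0 : ℝ)..(x - w), A s * B (x - w - s) =
        ∫ z in w..x, A (x - z) * B (z - w) := by
      have := intervalIntegral.integral_comp_sub_left
        (fun s => A s * B (x - w - s)) x (a := w) (b := x)
      rw [sub_self] at this
      rw [← this]
      refine intervalIntegral.integral_congr fun z _ => ?_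
      ring_nf
    have hii : ∀ c d, IntervalIntegrable (fun z => A (x - z) * B (z - w)) volume c d :=
      fun c d => (by fun_prop : Continuous _).intervalIntegrable c d
    have hsplit := intervalIntegral.integral_add_adjacent_intervals (hii w t) (hii t x)
    have hIoo : ∫ z in Ioo t (max x t), W r (x - z) * W (r + q) (z - w) =
        ∫ z in t..x, A (x - z) * B (z - w) := by
      rw [max_eq_left ht.2.le, intervalIntegral.integral_of_le ht.2.le,
        integral_Ioc_eq_integral_Ioo]
      refine setIntegral_congr_fun measurableSet_Ioo fun z hz => ?_
      rw [hA _ (by linarith [hz.2]), hB _ (by linarith [hz.1, hw.2])]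
    rw [hWWL, hIoo, hB _ (by linarith [hw.2, ht.2]), hres _ (by linarith [hw.2, ht.2]), hconv,
      ← hsplit]
    ring
  obtain ⟨J, hJdef⟩ : ∃ J : ℝ → ℝ, J = fun z => ∫ w in a..z, B (z - w) * G w := ⟨_, rfl⟩
  have hJc : Continuous J := by
    rw [hJdef]
    exact intervalIntegral.continuous_parametric_intervalIntegral_of_continuous
      (f := fun z w => B (z - w) * G w) (by unfold Function.uncurry; fun_prop) continuous_id
  have hΔ : ∀ t ∈ Ioo a x, ΔL t x a = (∫ w in a..t, A (x - w) * G w) +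
      q * (∫ z in a..t, A (x - z) * J z) - ∫ w in t..x, A (x - w) * C w := by
    intro t ht
    have hfirst : ∫ w in Ioo a t, WWL t x w * (q * v w - χ w) =
        ∫ w in a..t, (A (x - w) * G w + q * ∫ z in w..t, A (x - z) * B (z - w) * G w) := by
      rw [intervalIntegral.integral_of_le ht.1.le, integral_Ioc_eq_integral_Ioo]
      refine setIntegral_congr_fun measurableSet_Ioo fun w hw => ?_
      rw [hWWL_eq t ht w hw, hG w (ha.trans hw.1.le), intervalIntegral.integral_mul_const]
      ring
    have hlast : ∫ w in Ico t (max x t), W r (x - w) * χ w = ∫ w in t..x, A (x - w) * C w := by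
      rw [max_eq_left ht.2.le, intervalIntegral.integral_of_le ht.2.le,
        integral_Ioc_eq_integral_Ioo, integral_Ico_eq_integral_Ioo]
      refine setIntegral_congr_fun measurableSet_Ioo fun w hw => ?_
      rw [hA _ (by linarith [hw.2]), hC w (by linarith [hw.1, ht.1])]
    have hF : Continuous (Function.uncurry fun w z => A (x - z) * B (z - w) * G w) := by
      unfold Function.uncurry
      fun_prop
    have hinner : Continuous fun w => ∫ z in w..t, A (x - z) * B (z - w) * G w := by
      simp only [intervalIntegral.integral_symm t]
      exact (intervalIntegral.continuous_parametric_intervalIntegral_of_continuous hF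
        continuous_id).neg
    rw [hΔL, hfirst, hlast, intervalIntegral.integral_add
      ((by fun_prop : Continuous _).intervalIntegrable _ _)
      ((by fun_prop : Continuous _).intervalIntegrable _ _),
      intervalIntegral.integral_const_mul, integral_triangle_swap hF ht.1.le]
    simp only [mul_assoc, intervalIntegral.integral_const_mul, hJdef]
  have hΔdiag : ∀ t ∈ Ioo a x, ΔL t t a = J t := by
    intro t ht
    rw [hΔL, max_self, Ico_self, setIntegral_empty, sub_zero, hJdef]
    simp only
    rw [intervalIntegral.integral_of_le ht.1.le, integral_Ioc_eq_integral_Ioo]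
    refine setIntegral_congr_fun measurableSet_Ioo fun w hw => ?_
    rw [hWWL, max_self, Ioo_self, setIntegral_empty, mul_zero, sub_zero,
      hB _ (by linarith [hw.2]), hG w (ha.trans hw.1.le)]
  have hderiv : ∀ t ∈ Ioo a x,
      HasDerivAt (fun t => ΔL t x a) (q * W r (x - t) * (v t + ΔL t t a)) t := by
    intro t ht
    have hFTC : ∀ {k : ℝ → ℝ}, Continuous k → ∀ c,
        HasDerivAt (fun t => ∫ w in c..t, k w) (k t) t :=
      fun hk c => (hk.integral_hasStrictDerivAt c t).hasDerivAt
    have h3 : HasDerivAt (fun t => ∫ w in t..x, A (x - w) * C w) (-(A (x - t) * C t)) t := by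
      simp only [intervalIntegral.integral_symm x]
      exact (hFTC (by fun_prop) x).neg
    have hD := ((hFTC (k := fun w => A (x - w) * G w) (by fun_prop) a).add
      ((hFTC (k := fun z => A (x - z) * J z) (by fun_prop) a).const_mul q)).sub h3
    have heq : (fun t => ΔL t x a) =ᶠ[𝓝 t] fun t => (∫ w in a..t, A (x - w) * G w) +
        q * (∫ z in a..t, A (x - z) * J z) - ∫ w in t..x, A (x - w) * C w := by
      filter_upwards [isOpen_Ioo.mem_nhds ht] with s hs using hΔ s hs
    refine (hD.congr_of_eventuallyEq heq).congr_deriv ?_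
    rw [hΔdiag t ht, hA _ (by linarith [ht.2]), hv t (ha.trans ht.1.le), hGdef]
    ring
  have hpos : ∀ t ∈ Ioo a x, 0 < q * W r (x - t) * (v t + ΔL t t a) := by
    intro t ht
    have h1 : 0 < v t := by
      have : Kl ≤ exp t := hexpkl ▸ exp_le_exp.2 (ha.trans ht.1.le)
      have : 0 < Kl / p := by positivity
      rw [hv t (ha.trans ht.1.le)]
      linarith
    have h2 : 0 ≤ ΔL t t a := by
      rw [hΔdiag t ht, hJdef]
      refine intervalIntegral.integral_nonneg ht.1.le fun w hw => mul_nonneg ?_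
        (hGnn w (ha.trans hw.1))
      rw [hBdef]
      exact hWnn _ hp0 _
    exact mul_pos (mul_pos hq (hWpos r hr0 _ (by linarith [ht.2]))) (by linarith)
  refine ⟨hderiv y ⟨hay, hyx⟩, hpos y ⟨hay, hyx⟩,
    strictMonoOn_of_deriv_pos (convex_Ioo a x)
      (fun t ht => (hderiv t ht).continuousAt.continuousWithinAt) fun t ht => ?_⟩
  rw [interior_Ioo] at ht
  rw [(hderiv t ht).deriv]
  exact hpos t ht
end

section
/- Assume ψ(1) = r with ψ′(1) > 0, and assume e^{−x} W^{(r)}(x) → 1/ψ′(1) as x → ∞. Fix a < y and define W^{(r,q)}(b, a) = W^{(r)}(b − a) + q ∫_{(a,y)} W^{(r)}(b − z) W^{(r+q)}(z − a) dz for b > y. Then lim_{b→∞} e^{−b} W^{(r,q)}(b, a) = (1/ψ′(1)) · ( e^{−a} + q ∫_{(a,y)} e^{−z} W^{(r+q)}(z − a) dz ). -/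
open MeasureTheory Real Set Filter Topology

/-- If `e^{-x} f x → L` then `e^{-b} f (b - z) → L e^{-z}`. -/
theorem tendsto_exp_neg_mul_comp_sub {f : ℝ → ℝ} {L : ℝ}
    (hf : Tendsto (fun x => Real.exp (-x) * f x) atTop (𝓝 L)) (z : ℝ) :
    Tendsto (fun b => Real.exp (-b) * f (b - z)) atTop (𝓝 (L * Real.exp (-z))) := by
  have hshift : Tendsto (fun b : ℝ => b - z) atTop atTop :=
    tendsto_atTop_add_const_right _ (-z) tendsto_id
  refine ((hf.comp hshift).mul_const (Real.exp (-z))).congr fun b => ?_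
  have hexp : Real.exp (-b) = Real.exp (-(b - z)) * Real.exp (-z) := by
    rw [← Real.exp_add]
    ring_nf
  simp only [Function.comp_apply, hexp]
  ring

/-- Exponentially rescaled convolutions over a bounded interval converge when the rescaled
kernel does. -/
theorem tendsto_exp_neg_mul_setIntegral_comp_sub {f g : ℝ → ℝ} {L a y : ℝ}
    (hf_nonneg : ∀ x, 0 ≤ f x) (hf_cont : ContinuousOn f (Ici 0))
    (hf_mono : MonotoneOn f (Ici 0))
    (hf : Tendsto (fun x => Real.exp (-x) * f x) atTop (𝓝 L))
    (hg_nonneg : ∀ x, 0 ≤ g x) (hg_cont : ContinuousOn g (Ici 0))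
    (hg_mono : MonotoneOn g (Ici 0)) :
    Tendsto (fun b => Real.exp (-b) * ∫ z in Ioo a y, f (b - z) * g (z - a)) atTop
      (𝓝 (L * ∫ z in Ioo a y, Real.exp (-z) * g (z - a))) := by
  simp only [← integral_const_mul]
  have hlim_a := tendsto_exp_neg_mul_comp_sub hf a
  refine tendsto_integral_filter_of_dominated_convergence
    (fun _ => (L * Real.exp (-a) + 1) * g (y - a)) ?_ ?_ ?_ ?_
  · filter_upwards [eventually_ge_atTop y] with b hb
    refine ContinuousOn.aestronglyMeasurable ?_ measurableSet_Ioo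
    refine continuousOn_const.mul (ContinuousOn.mul ?_ ?_)
    · exact hf_cont.comp (by fun_prop) fun z hz => by
        simp only [mem_Ici, sub_nonneg]
        exact hz.2.le.trans hb
    · exact hg_cont.comp (by fun_prop) fun z hz => by
        simp only [mem_Ici, sub_nonneg]
        exact hz.1.le
  · filter_upwards [eventually_ge_atTop y,
      hlim_a.eventually_le_const (lt_add_one (L * Real.exp (-a)))] with b hb hbound
    filter_upwards [ae_restrict_mem measurableSet_Ioo] with z hz
    obtain ⟨haz, hzy⟩ := hz
    have hfz : f (b - z) ≤ f (b - a) :=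
      hf_mono (mem_Ici.2 (by linarith)) (mem_Ici.2 (by linarith)) (by linarith)
    have hgz : g (z - a) ≤ g (y - a) :=
      hg_mono (mem_Ici.2 (by linarith)) (mem_Ici.2 (by linarith)) (by linarith)
    have hfb : 0 ≤ Real.exp (-b) * f (b - z) := mul_nonneg (Real.exp_pos _).le (hf_nonneg _)
    have hle : Real.exp (-b) * f (b - z) ≤ L * Real.exp (-a) + 1 :=
      (mul_le_mul_of_nonneg_left hfz (Real.exp_pos _).le).trans hbound
    rw [← mul_assoc, Real.norm_of_nonneg (mul_nonneg hfb (hg_nonneg _))]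
    exact mul_le_mul hle hgz (hg_nonneg _) (hfb.trans hle)
  · exact integrable_const _
  · refine Eventually.of_forall fun z => ?_
    simpa only [mul_assoc] using
      (tendsto_exp_neg_mul_comp_sub hf z).mul_const (g (z - a))

/-- Display (5.5) (`limW`): in the martingale case `ψ(1) = r` with
`ψ′(1) > 0` and `e^{−x}W^{(r)}(x) → 1/ψ′(1)`, for fixed `a < y`,
`e^{−b} W^{(r,q)}(b,a) → (1/ψ′(1)) (e^{−a} + q ∫_{(a,y)} e^{−z} W^{(r+q)}(z−a) dz)`
as `b → ∞`. -/
theorem stmt16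
    (μ σ : ℝ) (ν : MeasureTheory.Measure ℝ)
    (hν : ν (Set.Ici 0) = 0)
    (hνint : ∫⁻ x, ENNReal.ofReal (min 1 (x ^ 2)) ∂ν ≠ ⊤)
    (ψ : ℝ → ℝ)
    (hψ : ∀ β : ℝ, 0 ≤ β →
      ψ β = μ * β + σ ^ 2 / 2 * β ^ 2 +
        ∫ z, (Real.exp (β * z) - 1 -
          Set.indicator (Set.Ioi (-1 : ℝ)) (fun t => β * t) z) ∂ν)
    (Φ : ℝ → ℝ)
    (hΦ : ∀ s : ℝ, 0 ≤ s → 0 ≤ Φ s ∧ ψ (Φ s) = s ∧ ∀ β : ℝ, Φ s < β → s < ψ β)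
    (r q : ℝ) (hr : 0 < r) (hq : 0 < q)
    (W : ℝ → ℝ → ℝ)
    (hWnn : ∀ s : ℝ, 0 ≤ s → ∀ x : ℝ, 0 ≤ W s x)
    (hWzero : ∀ s : ℝ, 0 ≤ s → ∀ x : ℝ, x < 0 → W s x = 0)
    (hWpos : ∀ s : ℝ, 0 ≤ s → ∀ x : ℝ, 0 < x → 0 < W s x)
    (hWcont : ∀ s : ℝ, 0 ≤ s → ContinuousOn (W s) (Set.Ici 0))
    (hWmono : ∀ s : ℝ, 0 ≤ s → MonotoneOn (W s) (Set.Ici 0))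
    (hWlap : ∀ s : ℝ, 0 ≤ s → ∀ β : ℝ, Φ s < β →
      ∫ x in Set.Ioi (0 : ℝ), Real.exp (-β * x) * W s x = 1 / (ψ β - s))
    (hmart : ψ 1 = r)
    (c : ℝ) (hc : 0 < c) (hψ'1 : HasDerivAt ψ c 1)
    (hlim : Filter.Tendsto (fun x => Real.exp (-x) * W r x) Filter.atTop (nhds (1 / c)))
    (a y : ℝ) (hay : a < y) :
    Filter.Tendsto
      (fun b => Real.exp (-b) *
        (W r (b - a) + q * ∫ z in Set.Ioo a y, W r (b - z) * W (r + q) (z - a)))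
      Filter.atTop
      (nhds ((1 / c) *
        (Real.exp (-a) + q * ∫ z in Set.Ioo a y, Real.exp (-z) * W (r + q) (z - a)))) := by
  have hrq : 0 ≤ r + q := by positivity
  have hconv := tendsto_exp_neg_mul_setIntegral_comp_sub (a := a) (y := y) (hWnn r hr.le)
    (hWcont r hr.le) (hWmono r hr.le) hlim (hWnn _ hrq) (hWcont _ hrq) (hWmono _ hrq)
  convert (tendsto_exp_neg_mul_comp_sub hlim a).add (hconv.const_mul q) using 2 <;> ring
end
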